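/- Let φ : ℝ → ℝ be a continuously differentiable function that is even, strictly positive, strictly decreasing on [0, ∞), and integrable on ℝ with integrable derivative. Define q_e(ξ) = (1/4)·∫_ℝ e^{−2|ξ−s|}·φ'(s) ds. Then q_e is an odd function and q_e(ξ) < 0 for every ξ > 0; in particular q_e has exactly one zero, at ξ = 0. -/

import Mathlib

open MeasureTheory

/-- The derivative of an even function is odd. -/
lemma deriv_neg_of_even {φ : ℝ → ℝ} (heven : ∀ x, φ (-x) = φ x) (s : ℝ) :
    deriv φ (-s) = -deriv φ s := by
  have h := deriv_comp_neg φ s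
  rw [funext heven] at h
  linarith

lemma integrable_exp_abs_mul {g : ℝ → ℝ} (hg : Integrable g) {a : ℝ → ℝ} (ha : Continuous a) :
    Integrable fun s => Real.exp (-2 * |a s|) * g s := by
  refine hg.bdd_mul (c := 1) (by fun_prop) (Filter.Eventually.of_forall fun s => ?_)
  rw [Real.norm_eq_abs, Real.abs_exp, Real.exp_le_one_iff]
  linarith [abs_nonneg (a s)]

lemma integral_exp_abs_add_of_odd {g : ℝ → ℝ} (hg : ∀ s, g (-s) = -g s) (ξ : ℝ) :
    ∫ s, Real.exp (-2 * |ξ + s|) * g s = -∫ s, Real.exp (-2 * |ξ - s|) * g s := by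
  rw [← integral_neg_eq_self, ← integral_neg]
  simp only [hg, mul_neg, ← sub_eq_add_neg]

/-- The convolution of `exp (-2 |·|)` with an odd function is odd. -/
lemma integral_exp_abs_sub_neg_of_odd {g : ℝ → ℝ} (hg : ∀ s, g (-s) = -g s) (ξ : ℝ) :
    ∫ s, Real.exp (-2 * |-ξ - s|) * g s = -∫ s, Real.exp (-2 * |ξ - s|) * g s := by
  rw [← integral_exp_abs_add_of_odd hg]
  congr! 5 with s
  rw [← abs_neg]
  ring_nf

/-- The convolution of `exp (-2 |·|)` with an odd function that is nonpositive, and somewhere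
negative, on the positive half-line is negative there. -/
lemma integral_exp_abs_sub_neg {g : ℝ → ℝ} (hodd : ∀ s, g (-s) = -g s) (hcont : Continuous g)
    (hint : Integrable g) (hnonpos : ∀ s, 0 < s → g s ≤ 0) {c : ℝ} (hc : 0 < c) (hgc : g c < 0)
    {ξ : ℝ} (hξ : 0 < ξ) :
    ∫ s, Real.exp (-2 * |ξ - s|) * g s < 0 := by
  have hlt : ∀ s, 0 < s → Real.exp (-2 * |ξ + s|) < Real.exp (-2 * |ξ - s|) := by
    intro s hs
    rw [Real.exp_lt_exp]
    have h : |ξ - s| < |ξ + s| := by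
      rw [abs_of_pos (add_pos hξ hs), abs_lt]
      constructor <;> linarith
    linarith
  set h : ℝ → ℝ := fun s => Real.exp (-2 * |ξ + s|) * g s - Real.exp (-2 * |ξ - s|) * g s with hh
  have hi₁ := integrable_exp_abs_mul hint (a := fun s => ξ + s) (by fun_prop)
  have hi₂ := integrable_exp_abs_mul hint (a := fun s => ξ - s) (by fun_prop)
  have heven : ∀ s, h (-s) = h s := by
    intro s
    simp only [hh, hodd, sub_neg_eq_add, ← sub_eq_add_neg]
    ring
  have hpos : ∀ s, 0 < s → 0 ≤ h s := by
    intro s hs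
    simp only [hh]
    nlinarith [hlt s hs, hnonpos s hs]
  have hnonneg : 0 ≤ h := by
    intro s
    rcases lt_trichotomy s 0 with hs | rfl | hs
    · rw [← heven]
      exact hpos _ (neg_pos.2 hs)
    · simp [hh]
    · exact hpos s hs
  have hne : h c ≠ 0 := by
    simp only [hh]
    nlinarith [mul_pos (sub_pos.2 (hlt c hc)) (neg_pos.2 hgc)]
  have hint_pos : 0 < ∫ s, h s :=
    integral_pos_of_integrable_nonneg_nonzero (by fun_prop) (hi₁.sub hi₂) hnonneg hne
  have heq : ∫ s, h s = -(2 * ∫ s, Real.exp (-2 * |ξ - s|) * g s) := by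
    rw [hh, integral_sub hi₁ hi₂, integral_exp_abs_add_of_odd hodd]
    ring
  linarith

/-- For an even, positive, strictly decreasing (on `[0,∞)`) integrable profile
`φ` with integrable derivative, the function `q_e = (4 − ∂²)⁻¹ ∂_ξ φ` is odd
and strictly negative on `(0, ∞)`; in particular its only zero is at `0`. -/
theorem DP_kernel_eigenfunction_sign (φ : ℝ → ℝ) (hφ : ContDiff ℝ 1 φ)
    (heven : ∀ ξ : ℝ, φ (-ξ) = φ ξ)
    (hpos : ∀ ξ : ℝ, 0 < φ ξ)
    (hanti : StrictAntiOn φ (Set.Ici 0))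
    (hint : Integrable φ) (hint' : Integrable (deriv φ)) :
    let q : ℝ → ℝ := fun ξ => (1 / 4) * ∫ s : ℝ, Real.exp (-2 * |ξ - s|) * deriv φ s
    (∀ ξ : ℝ, q (-ξ) = -q ξ) ∧ (∀ ξ : ℝ, 0 < ξ → q ξ < 0) ∧
      (∀ ξ : ℝ, q ξ = 0 ↔ ξ = 0) := by
  intro q
  have hgodd := deriv_neg_of_even heven
  have hnonpos : ∀ s, 0 < s → deriv φ s ≤ 0 := by
    intro s hs
    rw [← derivWithin_of_mem_nhds (Ici_mem_nhds hs)]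
    exact hanti.antitoneOn.derivWithin_nonpos
  obtain ⟨c, hc, hgc⟩ := exists_deriv_eq_slope φ zero_lt_one hφ.continuous.continuousOn
    (hφ.differentiable one_ne_zero).differentiableOn
  have hlt : deriv φ c < 0 := by
    rw [hgc]
    have := hanti (Set.mem_Ici.2 le_rfl) (Set.mem_Ici.2 zero_le_one) zero_lt_one
    linarith
  have hodd : ∀ ξ, q (-ξ) = -q ξ := by
    intro ξ
    simp only [q, integral_exp_abs_sub_neg_of_odd hgodd, mul_neg]
  have hneg : ∀ ξ, 0 < ξ → q ξ < 0 := fun ξ hξ =>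
    mul_neg_of_pos_of_neg (by norm_num)
      (integral_exp_abs_sub_neg hgodd (hφ.continuous_deriv le_rfl) hint' hnonpos hc.1 hlt hξ)
  refine ⟨hodd, hneg, fun ξ => ⟨fun h => ?_, ?_⟩⟩
  · rcases lt_trichotomy ξ 0 with hξ | hξ | hξ
    · linarith [hneg (-ξ) (neg_pos.2 hξ), hodd ξ]
    · exact hξ
    · linarith [hneg ξ hξ]
  · rintro rfl
    have := hodd 0
    rw [neg_zero] at this
    linarith
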